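/- Let ℓ ≥ 2 and let T_ℓ : C_ℓ → C_ℓ be the action of the SMART machine on cyclic tapes of length ℓ. Then T_ℓ^{2·3^ℓ}(C_q) = σ^{−1}(C_q) for q ∈ {▶, ▷}, and T_ℓ^{2·3^ℓ}(C_q) = σ(C_q) for q ∈ {◀, ◁}. Moreover, the intermediate configurations are pairwise distinct even up to a shift: for each q ∈ {▶,◀,▷,◁}, whenever 0 ≤ i < j < 2·3^ℓ and m ∈ ℤ/ℓℤ, one has T_ℓ^i(C_q) ≠ σ^m(T_ℓ^j(C_q)). -/

import Mathlib

/-! ### Turing machine symbols and local step functions -/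

/-- Tape/head symbols: a plain tape letter, or a head `(q, a)` on top of letter `a`. -/
abbrev TSym (Q Γ : Type) : Type := Γ ⊕ (Q × Γ)

/-- The tape letter carried by a cell (under the head if the cell carries the head). -/
def tapeLetter {Q Γ : Type} : TSym Q Γ → Γ
  | Sum.inl a => a
  | Sum.inr (_, a) => a

/-- A complete deterministic machine is given by a head-step function: at `(q, a)` it either
rewrites the head in place (`.inl (q', b)`, a matching transition), or moves in direction
`δ ∈ {+1, -1}` into state `q'` (`.inr (δ, q')`, a move transition). -/
abbrev HeadStep (Q Γ : Type) : Type := Q → Γ → ((Q × Γ) ⊕ (ℤ × Q))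

/-- If the symbol `s` carries a head about to move in direction `d`, the state in which the
head arrives; `none` otherwise. -/
def arrivesAs {Q Γ : Type} (δ : HeadStep Q Γ) (s : TSym Q Γ) (d : ℤ) : Option Q :=
  match s with
  | Sum.inl _ => none
  | Sum.inr (q, a) =>
    match δ q a with
    | Sum.inl _ => none
    | Sum.inr (d', q') => if d' = d then some q' else none

/-- The local rule of the moving-head dynamics: the new symbol of a cell, given the symbols
`l, c, r` of its left neighbour, itself, and its right neighbour. -/
def localStep {Q Γ : Type} (δ : HeadStep Q Γ) (l c r : TSym Q Γ) : TSym Q Γ :=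
  match c with
  | Sum.inr (q, a) =>
    (match δ q a with
     | Sum.inl qb => Sum.inr qb
     | Sum.inr _ => Sum.inl a)
  | Sum.inl a =>
    (match arrivesAs δ l 1 with
     | some q' => Sum.inr (q', a)
     | none =>
       match arrivesAs δ r (-1) with
       | some q' => Sum.inr (q', a)
       | none => Sum.inl a)

/-- The moving-head action of a complete deterministic machine on bi-infinite tapes. -/
def stepZ {Q Γ : Type} (δ : HeadStep Q Γ) (x : ℤ → TSym Q Γ) : ℤ → TSym Q Γ :=
  fun i => localStep δ (x (i - 1)) (x i) (x (i + 1))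

/-- The action of a complete deterministic machine on cyclic tapes of length `ℓ`. -/
def stepC {Q Γ : Type} (δ : HeadStep Q Γ) (ℓ : ℕ) (w : ZMod ℓ → TSym Q Γ) :
    ZMod ℓ → TSym Q Γ :=
  fun i => localStep δ (w (i - 1)) (w i) (w (i + 1))

/-- A configuration has at most one head. -/
def AtMostOneHeadZ {Q Γ : Type} (x : ℤ → TSym Q Γ) : Prop :=
  ∀ i j : ℤ, (x i).isRight = true → (x j).isRight = true → i = j

/-- A cyclic configuration has at most one head. -/
def AtMostOneHeadC {Q Γ : Type} {ℓ : ℕ} (w : ZMod ℓ → TSym Q Γ) : Prop :=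
  ∀ i j : ZMod ℓ, (w i).isRight = true → (w j).isRight = true → i = j

/-! ### The SMART machine -/

/-- The four arrows `▶, ◀, ▷, ◁` (filled right/left, hollow right/left). -/
inductive Arrow : Type
  | rf  -- ▶ (filled right)
  | lf  -- ◀ (filled left)
  | rh  -- ▷ (hollow right)
  | lh  -- ◁ (hollow left)
deriving DecidableEq

/-- The SMART state set `Q̊`: an arrow with a subscript in `{1,2}`; the subscript `b`
is represented by the `Fin 2` value `b - 1`. -/
abbrev SQ : Type := Arrow × Fin 2

/-- The SMART tape alphabet `{0,1,2}`. -/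
abbrev Letter : Type := Fin 3

/-- The head-step function of the SMART machine.  States `q₂` (second component `1`) are
move states; states `q₁` (second component `0`) are matching states. -/
def smartStep : HeadStep SQ Letter := fun q a =>
  if q.2 = 1 then
    match q.1 with
    | .rf => Sum.inr (1, (.rf, 0))   -- (▶₂, +1, ▶₁)
    | .lf => Sum.inr (-1, (.lf, 0))  -- (◀₂, −1, ◀₁)
    | .rh => Sum.inr (1, (.rh, 0))   -- (▷₂, +1, ▷₁)
    | .lh => Sum.inr (-1, (.lh, 0))  -- (◁₂, −1, ◁₁)
  else
    match q.1 with
    | .rf => Sum.inl (if a = 0 then ((.lf, 1), 1) else if a = 1 then ((.lh, 1), 1) else ((.lh, 1), 2))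
    | .lf => Sum.inl (if a = 0 then ((.rf, 1), 1) else if a = 1 then ((.rh, 1), 1) else ((.rh, 1), 2))
    | .rh => Sum.inl (if a = 0 then ((.rf, 1), 2) else if a = 1 then ((.rf, 1), 0) else ((.lh, 1), 0))
    | .lh => Sum.inl (if a = 0 then ((.lf, 1), 2) else if a = 1 then ((.lf, 1), 0) else ((.rh, 1), 0))

/-- The cyclic shift `σ(w)_i = w_{i+1}` on cyclic tapes of length `ℓ`. -/
def cshift {Q Γ : Type} {ℓ : ℕ} (w : ZMod ℓ → TSym Q Γ) : ZMod ℓ → TSym Q Γ :=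
  fun i => w (i + 1)

/-- The initial cyclic configuration `C_q` of length `ℓ`: all-zero tape with the head
`(q₁, 0)` at position `0`. -/
def initConf (ℓ : ℕ) (q : Arrow) : ZMod ℓ → TSym SQ Letter :=
  fun i => if i = 0 then Sum.inr ((q, 0), 0) else Sum.inl 0

/-! ### Combined steps: a matching transition followed by a move -/

namespace Smart

open Function

/-- Whether an arrow points to the right. -/
def pointsRight : Arrow → Bool
  | .rf => true
  | .rh => true
  | .lf => false
  | .lh => false

/-- The left-right reflection of arrows. -/
def mirror : Arrow → Arrow
  | .rf => .lf
  | .lf => .rf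
  | .rh => .lh
  | .lh => .rh

/-- The arrow and the letter produced by the matching transition of `q₁` reading `a`. -/
def turn (q : Arrow) (a : Letter) : Arrow × Letter :=
  match q with
  | .rf => if a = 0 then (.lf, 1) else (.lh, a)
  | .lf => if a = 0 then (.rf, 1) else (.rh, a)
  | .rh => if a = 0 then (.rf, 2) else if a = 1 then (.rf, 0) else (.lh, 0)
  | .lh => if a = 0 then (.lf, 2) else if a = 1 then (.lf, 0) else (.rh, 0)

lemma pointsRight_mirror (q : Arrow) : pointsRight (mirror q) = !pointsRight q := by
  cases q <;> rfl

lemma mirror_mirror (q : Arrow) : mirror (mirror q) = q := by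
  cases q <;> rfl

lemma turn_mirror (q : Arrow) (a : Letter) :
    turn (mirror q) a = (mirror (turn q a).1, (turn q a).2) := by
  cases q <;> fin_cases a <;> rfl

lemma smartStep_match (q : Arrow) (a : Letter) :
    smartStep (q, 0) a = Sum.inl (((turn q a).1, 1), (turn q a).2) := by
  cases q <;> fin_cases a <;> rfl

lemma smartStep_move (q : Arrow) (a : Letter) :
    smartStep (q, 1) a = Sum.inr (if pointsRight q then 1 else -1, (q, 0)) := by
  cases q <;> rfl

/-! ### Linear dynamics on zippers

A zipper `(u, q, v)` is a finite word `u.reverse ++ v` with the head at the boundary between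
`u.reverse` and `v`: it reads the first letter of `v` if `q` points to the right, and the first
letter of `u` otherwise. -/

/-- Finite words with a head sitting at the boundary between two letters. -/
abbrev Zipper : Type := List Letter × Arrow × List Letter

/-- Put the letter `b` back at the boundary, on the side that the arrow `q` leaves behind. -/
def place (q : Arrow) (b : Letter) (u v : List Letter) : Zipper :=
  if pointsRight q then (b :: u, q, v) else (u, q, b :: v)

/-- One combined step on zippers. -/
inductive ZStep : Zipper → Zipper → Prop
  | right (q : Arrow) (a : Letter) (u v : List Letter) (h : pointsRight q = true) :
      ZStep (u, q, a :: v) (place (turn q a).1 (turn q a).2 u v)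
  | left (q : Arrow) (a : Letter) (u v : List Letter) (h : pointsRight q = false) :
      ZStep (a :: u, q, v) (place (turn q a).1 (turn q a).2 u v)

/-- `ZRun n z z'`: the zipper `z` reaches `z'` in `n` combined steps. -/
inductive ZRun : ℕ → Zipper → Zipper → Prop
  | refl (z : Zipper) : ZRun 0 z z
  | tail {n : ℕ} {x y z : Zipper} : ZRun n x y → ZStep y z → ZRun (n + 1) x z

/-- The left-right reflection of zippers. -/
def Zipper.flip (z : Zipper) : Zipper := (z.2.2, mirror z.2.1, z.1)

lemma flip_place (q : Arrow) (b : Letter) (u v : List Letter) :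
    Zipper.flip (place q b u v) = place (mirror q) b v u := by
  cases q <;> rfl

lemma ZStep.flip {x y : Zipper} (h : ZStep x y) : ZStep x.flip y.flip := by
  cases h with
  | right q a u v h =>
    have := ZStep.left (mirror q) a v u (by simp [pointsRight_mirror, h])
    rwa [turn_mirror, ← flip_place] at this
  | left q a u v h =>
    have := ZStep.right (mirror q) a v u (by simp [pointsRight_mirror, h])
    rwa [turn_mirror, ← flip_place] at this

lemma ZRun.flip {n : ℕ} {x y : Zipper} (h : ZRun n x y) : ZRun n x.flip y.flip := by
  induction h with
  | refl z => exact .refl _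
  | tail _ hs ih => exact ih.tail hs.flip

lemma ZRun.trans {m n : ℕ} {x y z : Zipper} (h : ZRun m x y) (h' : ZRun n y z) :
    ZRun (m + n) x z := by
  induction h' with
  | refl z => exact h
  | tail _ hs ih => exact (ih h).tail hs

lemma ZRun.of_eq {m n : ℕ} {x y : Zipper} (h : ZRun m x y) (e : m = n) : ZRun n x y := e ▸ h

/-- The word `v` preceded by `k` zeros. -/
def zeros (k : ℕ) (v : List Letter) : List Letter := List.replicate k 0 ++ v

lemma zeros_cons (k : ℕ) (v : List Letter) : zeros k (0 :: v) = zeros (k + 1) v := by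
  simp [zeros, List.replicate_succ']

/-- The number `(3 ^ (n + 1) - 1) / 2` of combined steps needed to sweep `n + 1` cells. -/
def sweepTime : ℕ → ℕ
  | 0 => 1
  | n + 1 => sweepTime n + 3 ^ (n + 1)

lemma two_mul_sweepTime (n : ℕ) : 2 * sweepTime n + 1 = 3 ^ (n + 1) := by
  induction n with
  | zero => rfl
  | succ n ih => rw [sweepTime, pow_succ 3 (n + 1)]; omega

/-- How the head sweeps through blocks of zeros, in any surrounding context. -/
structure Sweeps (n : ℕ) : Prop where
  cross_filled (u v : List Letter) :
    ZRun (sweepTime n) (0 :: u, .lf, zeros n v) (zeros n (1 :: u), .rf, v)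
  cross_hollow (u v : List Letter) :
    ZRun (sweepTime n) (u, .rh, zeros (n + 1) v) (zeros n (2 :: u), .rf, v)
  erase_one (u v : List Letter) :
    ZRun (sweepTime n) (u, .rh, zeros n (1 :: v)) (zeros (n + 1) u, .rf, v)
  bounce (y : Letter) (hy : y ≠ 0) (u v : List Letter) :
    ZRun (3 ^ (n + 1)) (0 :: u, .lf, zeros n (y :: v)) (u, .lf, zeros (n + 1) (y :: v))
  erase_pair (u v : List Letter) :
    ZRun (3 ^ (n + 1)) (zeros n (2 :: u), .rf, 1 :: v) (zeros (n + 2) u, .rf, v)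
  gather (u v : List Letter) :
    ZRun (3 ^ (n + 1) - 3) (2 :: u, .lf, zeros n (2 :: v)) (2 :: u, .lf, 2 :: zeros n v)
  carry (u v : List Letter) :
    ZRun (2 * sweepTime n + 3 ^ (n + 1)) (zeros (n + 1) (2 :: u), .lh, v)
      (zeros n (2 :: 0 :: u), .rf, v)

section SingleSteps

variable (u v : List Letter)

lemma step_lf_zero : ZStep (0 :: u, .lf, v) (1 :: u, .rf, v) := .left .lf 0 u v rfl

lemma step_lf_two : ZStep (2 :: u, .lf, v) (2 :: u, .rh, v) := .left .lf 2 u v rfl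

lemma step_lf_one : ZStep (1 :: u, .lf, v) (1 :: u, .rh, v) := .left .lf 1 u v rfl

lemma step_lh_two : ZStep (2 :: u, .lh, v) (0 :: u, .rh, v) := .left .lh 2 u v rfl

lemma step_rh_zero : ZStep (u, .rh, 0 :: v) (2 :: u, .rf, v) := .right .rh 0 u v rfl

lemma step_rh_one : ZStep (u, .rh, 1 :: v) (0 :: u, .rf, v) := .right .rh 1 u v rfl

lemma step_rh_two : ZStep (u, .rh, 2 :: v) (u, .lh, 0 :: v) := .right .rh 2 u v rfl

lemma step_rf_of_ne_zero {y : Letter} (hy : y ≠ 0) : ZStep (u, .rf, y :: v) (u, .lh, y :: v) := by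
  simpa [place, turn, hy, pointsRight] using ZStep.right .rf y u v rfl

end SingleSteps

lemma ZStep.run {x y : Zipper} (h : ZStep x y) : ZRun 1 x y := (ZRun.refl x).tail h

lemma bounce_of_cross {n : ℕ}
    (hc : ∀ u v, ZRun (sweepTime n) (0 :: u, .lf, zeros n v) (zeros n (1 :: u), .rf, v))
    (he : ∀ u v, ZRun (sweepTime n) (u, .rh, zeros n (1 :: v)) (zeros (n + 1) u, .rf, v))
    (y : Letter) (hy : y ≠ 0) (u v : List Letter) :
    ZRun (3 ^ (n + 1)) (0 :: u, .lf, zeros n (y :: v)) (u, .lf, zeros (n + 1) (y :: v)) :=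
  (((hc u (y :: v)).tail (step_rf_of_ne_zero _ _ hy)).trans (he (y :: v) u).flip).of_eq <| by
    have := two_mul_sweepTime n
    omega

lemma carry_of_cross {n : ℕ}
    (hc : ∀ u v, ZRun (sweepTime n) (u, .rh, zeros (n + 1) v) (zeros n (2 :: u), .rf, v))
    (hg : ∀ u v, ZRun (3 ^ (n + 1) - 3) (2 :: u, .lf, zeros n (2 :: v))
      (2 :: u, .lf, 2 :: zeros n v))
    (u v : List Letter) :
    ZRun (2 * sweepTime n + 3 ^ (n + 1)) (zeros (n + 1) (2 :: u), .lh, v)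
      (zeros n (2 :: 0 :: u), .rf, v) :=
  ((((((hc v (2 :: u)).flip.trans (hg u v)).tail (step_lf_two _ _)).tail
    (step_rh_two _ _)).tail (step_lh_two _ _)).trans (hc (0 :: u) v)).of_eq <| by
    have := two_mul_sweepTime n
    have := Nat.pow_le_pow_right (n := 3) (by norm_num) (show 1 ≤ n + 1 by omega)
    omega

theorem sweeps (n : ℕ) : Sweeps n := by
  induction n with
  | zero =>
    have hc (u v) : ZRun (sweepTime 0) (0 :: u, .lf, zeros 0 v) (zeros 0 (1 :: u), .rf, v) :=
      (step_lf_zero u v).run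
    have hh (u v) : ZRun (sweepTime 0) (u, .rh, zeros 1 v) (zeros 0 (2 :: u), .rf, v) :=
      (step_rh_zero u v).run
    have he (u v) : ZRun (sweepTime 0) (u, .rh, zeros 0 (1 :: v)) (zeros 1 u, .rf, v) :=
      (step_rh_one u v).run
    have hg (u v) : ZRun (3 ^ (0 + 1) - 3) (2 :: u, .lf, zeros 0 (2 :: v))
      (2 :: u, .lf, 2 :: zeros 0 v) := ZRun.refl _
    exact
      { cross_filled := hc
        cross_hollow := hh
        erase_one := he
        bounce := bounce_of_cross hc he
        erase_pair := fun u v =>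
          (((step_rf_of_ne_zero (2 :: u) v one_ne_zero).run.tail (step_lh_two u (1 :: v))).tail
            (step_rh_one (0 :: u) v))
        gather := hg
        carry := carry_of_cross hh hg }
  | succ n ih =>
    have hb (y : Letter) (hy : y ≠ 0) (u v : List Letter) :
        ZRun (3 ^ (n + 1)) (zeros n (y :: u), .rf, 0 :: v) (zeros (n + 1) (y :: u), .rf, v) :=
      (ih.bounce y hy v u).flip
    have hc (u v) : ZRun (sweepTime (n + 1)) (0 :: u, .lf, zeros (n + 1) v)
        (zeros (n + 1) (1 :: u), .rf, v) := by
      have := ih.cross_filled u (0 :: v)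
      rw [zeros_cons] at this
      exact this.trans (hb 1 one_ne_zero u v)
    have hh (u v) : ZRun (sweepTime (n + 1)) (u, .rh, zeros (n + 2) v)
        (zeros (n + 1) (2 :: u), .rf, v) := by
      have := ih.cross_hollow u (0 :: v)
      rw [zeros_cons] at this
      exact this.trans (hb 2 (by decide) u v)
    have he (u v) : ZRun (sweepTime (n + 1)) (u, .rh, zeros (n + 1) (1 :: v))
        (zeros (n + 2) u, .rf, v) :=
      (ih.cross_hollow u (1 :: v)).trans (ih.erase_pair u v)
    have hp (u v) : ZRun (3 ^ (n + 2)) (zeros (n + 1) (2 :: u), .rf, 1 :: v)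
        (zeros (n + 3) u, .rf, v) := by
      have := ih.erase_pair (0 :: u) v
      rw [zeros_cons] at this
      refine (((step_rf_of_ne_zero _ v one_ne_zero).run.trans (ih.carry u (1 :: v))).trans
        this).of_eq ?_
      have := two_mul_sweepTime n
      rw [pow_succ 3 (n + 1)]
      omega
    have hg (u v) : ZRun (3 ^ (n + 2) - 3) (2 :: u, .lf, zeros (n + 1) (2 :: v))
        (2 :: u, .lf, 2 :: zeros (n + 1) v) := by
      have := ih.gather u (0 :: v)
      rw [zeros_cons] at this
      refine (((step_lf_two u _).run.trans (ih.carry v (2 :: u)).flip).trans this).of_eq ?_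
      have := two_mul_sweepTime n
      have := Nat.pow_le_pow_right (n := 3) (by norm_num) (show 1 ≤ n + 1 by omega)
      rw [pow_succ 3 (n + 1)]
      omega
    exact
      { cross_filled := hc
        cross_hollow := hh
        erase_one := he
        bounce := bounce_of_cross hc he
        erase_pair := hp
        gather := hg
        carry := carry_of_cross hh hg }

/-! ### Cyclic dynamics -/

variable {ℓ : ℕ}

/-- A cyclic tape, a head position and an arrow. -/
abbrev Cyc (ℓ : ℕ) : Type := (ZMod ℓ → Letter) × ZMod ℓ × Arrow

/-- The displacement of a head in state `q₂`. -/
def disp (ℓ : ℕ) (q : Arrow) : ZMod ℓ := if pointsRight q then 1 else -1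

/-- One combined step on cyclic tapes. -/
def cycStep (c : Cyc ℓ) : Cyc ℓ :=
  (update c.1 c.2.1 (turn c.2.2 (c.1 c.2.1)).2,
    c.2.1 + disp ℓ (turn c.2.2 (c.1 c.2.1)).1, (turn c.2.2 (c.1 c.2.1)).1)

/-- The cyclic configuration with tape `t` and head state `Q` at position `h`. -/
def headConf (t : ZMod ℓ → Letter) (h : ZMod ℓ) (Q : SQ) : ZMod ℓ → TSym SQ Letter :=
  fun x => if x = h then Sum.inr (Q, t x) else Sum.inl (t x)

lemma stepC_headConf_match (t : ZMod ℓ → Letter) (h : ZMod ℓ) (q : Arrow) :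
    stepC smartStep ℓ (headConf t h (q, 0)) =
      headConf (update t h (turn q (t h)).2) h ((turn q (t h)).1, 1) := by
  have harr (x : ZMod ℓ) (d : ℤ) : arrivesAs smartStep (headConf t h (q, 0) x) d = none := by
    by_cases hx : x = h <;> simp [headConf, hx, arrivesAs, smartStep_match]
  funext x
  simp only [stepC, localStep, harr]
  by_cases hx : x = h
  · subst hx
    simp [headConf, smartStep_match]
  · simp [headConf, hx]

lemma stepC_headConf_move (hℓ : 2 ≤ ℓ) (t : ZMod ℓ → Letter) (h : ZMod ℓ) (q : Arrow) :
    stepC smartStep ℓ (headConf t h (q, 1)) = headConf t (h + disp ℓ q) (q, 0) := by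
  have : Fact (1 < ℓ) := ⟨hℓ⟩
  have harr (x : ZMod ℓ) (d : ℤ) : arrivesAs smartStep (headConf t h (q, 1) x) d =
      if x = h ∧ (if pointsRight q then 1 else -1) = d then some (q, 0) else none := by
    by_cases hx : x = h <;> simp [headConf, hx, arrivesAs, smartStep_move]
  funext x
  simp only [stepC, localStep, harr]
  by_cases hx : x = h
  · subst hx
    cases hq : pointsRight q <;> simp [headConf, smartStep_move, disp, hq]
  · cases hq : pointsRight q <;>
      simp [headConf, disp, hq, hx, sub_eq_iff_eq_add, eq_sub_iff_add_eq, ← sub_eq_add_neg] <;>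
      split_ifs <;> rfl

lemma stepC_iterate_headConf (hℓ : 2 ≤ ℓ) (n : ℕ) (c : Cyc ℓ) :
    (stepC smartStep ℓ)^[2 * n] (headConf c.1 c.2.1 (c.2.2, 0)) =
      headConf (cycStep^[n] c).1 (cycStep^[n] c).2.1 ((cycStep^[n] c).2.2, 0) := by
  induction n with
  | zero => rfl
  | succ n ih =>
    rw [mul_add, mul_one, iterate_succ_apply', iterate_succ_apply', ih, iterate_succ_apply',
      stepC_headConf_match, stepC_headConf_move hℓ, cycStep]

/-- The left-right reflection of cyclic configurations. -/
def Cyc.flip (c : Cyc ℓ) : Cyc ℓ := (fun x => c.1 (-x), -c.2.1, mirror c.2.2)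

lemma cycStep_flip (c : Cyc ℓ) : cycStep c.flip = (cycStep c).flip := by
  obtain ⟨t, h, q⟩ := c
  simp only [cycStep, Cyc.flip, turn_mirror, neg_neg, Prod.mk.injEq, and_true]
  constructor
  · funext x
    by_cases hx : x = -h
    · simp [hx]
    · have : -x ≠ h := fun e => hx (by rw [← e, neg_neg])
      simp [hx, this]
  · cases hq : pointsRight (turn q (t h)).1 <;> simp [disp, pointsRight_mirror, hq] <;> ring

lemma cycStep_iterate_flip (n : ℕ) (c : Cyc ℓ) : cycStep^[n] c.flip = (cycStep^[n] c).flip :=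
  ((show Semiconj Cyc.flip cycStep cycStep from fun c => (cycStep_flip c).symm).iterate_right n
    c).symm

/-! ### Wrapping zippers around a cycle -/

/-- The word `s` written on the cycle from position `o` on. -/
def ringTape (ℓ : ℕ) (o : ZMod ℓ) (s : List Letter) : ZMod ℓ → Letter :=
  fun x => s.getD (x - o).val 0

/-- The zipper `z` written on the cycle from position `o` on. -/
def wrap (ℓ : ℕ) (o : ZMod ℓ) (z : Zipper) : Cyc ℓ :=
  (ringTape ℓ o (z.1.reverse ++ z.2.2),
    o + z.1.length - (if pointsRight z.2.1 then 0 else 1), z.2.1)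

lemma update_ringTape [NeZero ℓ] (o : ZMod ℓ) (s : List Letter) {i : ℕ} (hi : i < ℓ)
    (hs : s.length = ℓ) (b : Letter) :
    update (ringTape ℓ o s) (o + i) b = ringTape ℓ o (s.set i b) := by
  funext x
  by_cases hx : x = o + i
  · subst hx
    simp [ringTape, ZMod.val_cast_of_lt hi, hs, hi, List.getD_eq_getElem?_getD]
  · have : i ≠ (x - o).val := by
      rintro rfl
      simp at hx
    simp [ringTape, hx, List.getD_eq_getElem?_getD, List.getElem?_set_ne this]

lemma cycStep_wrap [NeZero ℓ] (o : ZMod ℓ) {z z' : Zipper} (hz : z.1.length + z.2.2.length = ℓ)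
    (h : ZStep z z') : cycStep (wrap ℓ o z) = wrap ℓ o z' := by
  have key (u : List Letter) (a : Letter) (v : List Letter) (q : Arrow)
      (hl : u.length + 1 + v.length = ℓ) :
      cycStep (ringTape ℓ o (u.reverse ++ a :: v), o + u.length, q) =
        wrap ℓ o (place (turn q a).1 (turn q a).2 u v) := by
    have hi : u.length < ℓ := by omega
    have ha : ringTape ℓ o (u.reverse ++ a :: v) (o + u.length) = a := by
      simp [ringTape, ZMod.val_cast_of_lt hi, List.getD_eq_getElem?_getD]
    have hs : (u.reverse ++ a :: v).length = ℓ := by simp; omega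
    simp only [cycStep, ha, update_ringTape o _ hi hs]
    cases hq : pointsRight (turn q a).1 <;>
      simp [wrap, place, hq, disp, sub_eq_add_neg, add_assoc]
  cases h with
  | right q a u v h =>
    rw [← key u a v q (by simp at hz; omega)]
    simp [wrap, h]
  | left q a u v h =>
    rw [← key u a v q (by simpa using hz)]
    simp [wrap, h, ← add_assoc]

lemma ZStep.length_eq {z z' : Zipper} (h : ZStep z z') :
    z'.1.length + z'.2.2.length = z.1.length + z.2.2.length := by
  cases h with
  | right q a u v h =>
    cases hq : pointsRight (turn q a).1 <;> simp [place, hq]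
    omega
  | left q a u v h =>
    cases hq : pointsRight (turn q a).1 <;> simp [place, hq]
    omega

lemma ZRun.length_eq {n : ℕ} {z z' : Zipper} (h : ZRun n z z') :
    z'.1.length + z'.2.2.length = z.1.length + z.2.2.length := by
  induction h with
  | refl z => rfl
  | tail _ hs ih => rw [hs.length_eq, ih]

lemma ZRun.iterate_wrap [NeZero ℓ] (o : ZMod ℓ) {n : ℕ} {z z' : Zipper} (h : ZRun n z z')
    (hz : z.1.length + z.2.2.length = ℓ) : cycStep^[n] (wrap ℓ o z) = wrap ℓ o z' := by
  induction h with
  | refl z => rfl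
  | tail hr hs ih => rw [iterate_succ_apply', ih hz, cycStep_wrap o (hr.length_eq.trans hz) hs]

lemma wrap_left_end (o : ZMod ℓ) {q : Arrow} {v : List Letter} (hv : v.length = ℓ) :
    wrap ℓ o (v.reverse, q, []) = wrap ℓ o ([], q, v) := by
  simp [wrap, hv]

lemma length_zeros (k : ℕ) (v : List Letter) : (zeros k v).length = k + v.length := by
  simp [zeros]

lemma reverse_zeros (k : ℕ) (v : List Letter) : (zeros k v).reverse = v.reverse ++ zeros k [] := by
  simp [zeros]

lemma zeros_append (k : ℕ) (v w : List Letter) : zeros k v ++ w = zeros k (v ++ w) := by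
  simp [zeros]

lemma ringTape_zeros (o : ZMod ℓ) (k : ℕ) : ringTape ℓ o (zeros k []) = 0 := by
  funext x
  simp only [ringTape, zeros, List.append_nil, List.getD_eq_getElem?_getD, List.getElem?_replicate]
  split_ifs <;> rfl

/-- The blank cyclic configuration with the head at position `h`. -/
def blank (ℓ : ℕ) (h : ZMod ℓ) (q : Arrow) : Cyc ℓ := (0, h, q)

lemma wrap_zeros (o : ZMod ℓ) (i j : ℕ) (q : Arrow) :
    wrap ℓ o (zeros i [], q, zeros j []) =
      blank ℓ (o + i - (if pointsRight q then 0 else 1)) q := by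
  simp [wrap, blank, reverse_zeros, zeros_append, length_zeros, ringTape_zeros,
    show zeros i (zeros j []) = zeros (i + j) [] by simp [zeros]]

variable (n : ℕ)

lemma wrap_blank_rf : wrap (n + 2) 1 (zeros (n + 1) [], .rf, [0]) = blank (n + 2) 0 .rf := by
  have h0 : ((n + 2 : ℕ) : ZMod (n + 2)) = 0 := ZMod.natCast_self _
  refine (wrap_zeros (ℓ := n + 2) 1 (n + 1) 1 .rf).trans ?_
  simp only [pointsRight, if_true, sub_zero]
  congr 1
  push_cast at h0 ⊢
  linear_combination h0

lemma iterate_blank_rf :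
    cycStep^[3 ^ (n + 2)] (blank (n + 2) 0 .rf) = blank (n + 2) 1 .rf := by
  have h₁ : ZRun _ (zeros (n + 1) [], .rf, [0]) ([], .lf, zeros (n + 1) [1]) :=
    ((sweeps (n + 1)).cross_filled [] []).flip
  have h₂ : ZRun 1 ((zeros (n + 1) [1]).reverse, .lf, [])
      ((zeros (n + 1) [1]).reverse, .rh, []) := by
    rw [reverse_zeros]
    exact (step_lf_one (zeros (n + 1) []) []).run
  have h₃ := (sweeps (n + 1)).erase_one [] []
  have hlen : (zeros (n + 1) [(1 : Letter)]).length = n + 2 := by simp [length_zeros]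
  have htime : 3 ^ (n + 2) = sweepTime (n + 1) + 1 + sweepTime (n + 1) := by
    have : _ = 3 ^ (n + 2) := two_mul_sweepTime (n + 1)
    omega
  rw [htime, iterate_add_apply, ← wrap_blank_rf, h₁.iterate_wrap 1 (by simp [length_zeros]),
    ← wrap_left_end _ hlen, iterate_add_apply,
    h₂.iterate_wrap 1 (by simp [length_zeros]), wrap_left_end _ hlen,
    h₃.iterate_wrap 1 (by simp [length_zeros])]
  refine (wrap_zeros (ℓ := n + 2) 1 (n + 2) 0 .rf).trans ?_
  rw [ZMod.natCast_self]
  simp [pointsRight]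

lemma iterate_blank_rf_third :
    (cycStep^[3 ^ (n + 1)] (blank (n + 2) 0 .rf)).2.2 = .lh := by
  have h₁ : ZRun _ (zeros n [0], .rf, [0]) ([0], .lf, zeros n [1]) :=
    ((sweeps n).cross_filled [] [0]).flip
  have h := (h₁.trans ((sweeps n).cross_filled [] [1])).tail
    (step_rf_of_ne_zero _ [] one_ne_zero)
  rw [← two_mul, two_mul_sweepTime, zeros_cons] at h
  rw [← wrap_blank_rf, h.iterate_wrap 1 (by simp [length_zeros])]
  rfl

lemma iterate_blank_rh_two_thirds :
    cycStep^[2 * 3 ^ (n + 1)] (blank (n + 2) 0 .rh) =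
      wrap (n + 2) 0 ([2], .lf, zeros n [2]) := by
  have hstart : wrap (n + 2) 0 ([], .rh, zeros (n + 2) []) = blank (n + 2) 0 .rh :=
    (wrap_zeros (ℓ := n + 2) 0 0 (n + 2) .rh).trans (by simp [pointsRight])
  have h₁ := (sweeps (n + 1)).cross_hollow [] []
  have hrev : zeros (n + 1) [2] = (2 :: zeros (n + 1) []).reverse := by
    simp [reverse_zeros, zeros_append]
  have h₂ : ZRun 1 ([], .rf, 2 :: zeros (n + 1) []) ([], .lh, 2 :: zeros (n + 1) []) :=
    (step_rf_of_ne_zero [] _ (by decide)).run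
  have h₃ : ZRun _ (zeros (n + 1) [2], .lh, []) ([2], .lf, zeros n [2]) :=
    ((sweeps n).cross_hollow [] [2]).flip
  have hlen : (2 :: zeros (n + 1) []).length = n + 2 := by simp [length_zeros]
  have htime : 2 * 3 ^ (n + 1) = sweepTime n + 1 + sweepTime (n + 1) := by
    have := two_mul_sweepTime n
    rw [sweepTime]
    omega
  rw [htime, iterate_add_apply, ← hstart, h₁.iterate_wrap 0 (by simp [length_zeros]), hrev,
    wrap_left_end _ hlen, iterate_add_apply, h₂.iterate_wrap 0 (by simp [length_zeros]),
    ← wrap_left_end _ hlen, ← hrev, h₃.iterate_wrap 0 (by simp [length_zeros])]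

lemma iterate_blank_rh :
    cycStep^[3 ^ (n + 2)] (blank (n + 2) 0 .rh) = blank (n + 2) 1 .rh := by
  have h := ((((sweeps n).gather [] []).tail (step_lf_two [] (2 :: zeros n []))).tail
    (step_rh_two [2] (zeros n []))).tail (step_lh_two [] (0 :: zeros n []))
  have htime : 3 ^ (n + 2) = 3 ^ (n + 1) - 3 + 1 + 1 + 1 + 2 * 3 ^ (n + 1) := by
    have := Nat.pow_le_pow_right (n := 3) (by norm_num) (show 1 ≤ n + 1 by omega)
    rw [pow_succ 3 (n + 1)]
    omega
  rw [htime, iterate_add_apply, iterate_blank_rh_two_thirds,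
    h.iterate_wrap 0 (by simp [length_zeros]; omega)]
  exact (wrap_zeros (ℓ := n + 2) 0 1 (n + 1) .rh).trans (by simp [pointsRight])

lemma blank_flip (h : ZMod ℓ) (q : Arrow) : (blank ℓ h q).flip = blank ℓ (-h) (mirror q) := rfl

lemma iterate_blank (q : Arrow) :
    cycStep^[3 ^ (n + 2)] (blank (n + 2) 0 q) = blank (n + 2) (disp (n + 2) q) q := by
  have hflip (q : Arrow)
      (h : cycStep^[3 ^ (n + 2)] (blank (n + 2) 0 q) = blank (n + 2) 1 q) :
      cycStep^[3 ^ (n + 2)] (blank (n + 2) 0 (mirror q)) = blank (n + 2) (-1) (mirror q) := by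
    rw [← blank_flip, ← h, ← cycStep_iterate_flip, blank_flip, neg_zero]
  cases q with
  | rf => exact iterate_blank_rf n
  | rh => exact iterate_blank_rh n
  | lf => exact hflip .rf (iterate_blank_rf n)
  | lh => exact hflip .rh (iterate_blank_rh n)

lemma exists_iterate_blank_ne (q : Arrow) :
    ∃ k, (cycStep^[k * 3 ^ (n + 1)] (blank (n + 2) 0 q)).2.2 ≠ q := by
  have hflip (q : Arrow) (h : ∃ k, (cycStep^[k * 3 ^ (n + 1)] (blank (n + 2) 0 q)).2.2 ≠ q) :
      ∃ k, (cycStep^[k * 3 ^ (n + 1)] (blank (n + 2) 0 (mirror q))).2.2 ≠ mirror q := by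
    obtain ⟨k, hk⟩ := h
    refine ⟨k, fun e => hk ?_⟩
    rw [← neg_zero, ← blank_flip, cycStep_iterate_flip] at e
    have e' : mirror _ = mirror q := e
    simpa [mirror_mirror] using congrArg mirror e'
  have hrf : ∃ k, (cycStep^[k * 3 ^ (n + 1)] (blank (n + 2) 0 .rf)).2.2 ≠ .rf :=
    ⟨1, by rw [one_mul, iterate_blank_rf_third]; decide⟩
  have hrh : ∃ k, (cycStep^[k * 3 ^ (n + 1)] (blank (n + 2) 0 .rh)).2.2 ≠ .rh :=
    ⟨2, by rw [iterate_blank_rh_two_thirds]; exact show Arrow.lf ≠ .rh by decide⟩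
  cases q with
  | rf => exact hrf
  | rh => exact hrh
  | lf => exact hflip .rf hrf
  | lh => exact hflip .rh hrh

/-! ### Configurations up to a shift -/

/-- Equality of cyclic configurations up to a shift. -/
def shiftSetoid (ℓ : ℕ) : Setoid (ZMod ℓ → TSym SQ Letter) where
  r w w' := ∃ m, w = fun t => w' (t + m)
  iseqv :=
    { refl := fun w => ⟨0, by simp⟩
      symm := by
        rintro w w' ⟨m, rfl⟩
        exact ⟨-m, by simp⟩
      trans := by
        rintro w w' w'' ⟨m, rfl⟩ ⟨m', rfl⟩
        exact ⟨m + m', by simp [add_assoc]⟩ }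

/-- The machine acting on cyclic configurations up to a shift. -/
def shiftStep (ℓ : ℕ) : Quotient (shiftSetoid ℓ) → Quotient (shiftSetoid ℓ) :=
  Quotient.map (stepC smartStep ℓ) <| by
    rintro w w' ⟨m, rfl⟩
    refine ⟨m, funext fun x => ?_⟩
    simp [stepC, sub_add_eq_add_sub, add_right_comm]

lemma shiftStep_iterate_mk (k : ℕ) (w : ZMod ℓ → TSym SQ Letter) :
    (shiftStep ℓ)^[k] (Quotient.mk _ w) = Quotient.mk _ ((stepC smartStep ℓ)^[k] w) :=
  ((show Semiconj (Quotient.mk (shiftSetoid ℓ)) (stepC smartStep ℓ) (shiftStep ℓ) from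
    fun _ => rfl).iterate_right k w).symm

lemma state_eq_of_mk_headConf_eq {t t' : ZMod ℓ → Letter} {h h' : ZMod ℓ} {Q Q' : SQ}
    (e : Quotient.mk (shiftSetoid ℓ) (headConf t h Q) = Quotient.mk _ (headConf t' h' Q')) :
    Q = Q' := by
  obtain ⟨m, hm⟩ := Quotient.exact e
  have := congrFun hm h
  by_cases hh : h + m = h' <;> simp [headConf, hh] at this
  exact this.1

lemma iterate_two_mul_initConf (k : ℕ) (q : Arrow) :
    (stepC smartStep (n + 2))^[2 * k] (initConf (n + 2) q) =
      headConf (cycStep^[k] (blank (n + 2) 0 q)).1 (cycStep^[k] (blank (n + 2) 0 q)).2.1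
        ((cycStep^[k] (blank (n + 2) 0 q)).2.2, 0) :=
  stepC_iterate_headConf (by omega) k (blank (n + 2) 0 q)

lemma iterate_initConf (q : Arrow) :
    (stepC smartStep (n + 2))^[2 * 3 ^ (n + 2)] (initConf (n + 2) q) =
      fun i => initConf (n + 2) q (i - disp (n + 2) q) := by
  rw [iterate_two_mul_initConf, iterate_blank]
  funext i
  by_cases hi : i = disp (n + 2) q <;> simp [blank, headConf, initConf, sub_eq_zero, hi]

lemma eq_two_mul_three_pow {d k : ℕ} (hd : d ∣ 2 * 3 ^ (k + 1)) (h₁ : ¬ d ∣ 3 ^ (k + 1))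
    (h₂ : ¬ d ∣ 2 * 3 ^ k) : d = 2 * 3 ^ (k + 1) := by
  obtain ⟨a, b, ha, hb, rfl⟩ := (Nat.dvd_mul).1 hd
  obtain ⟨j, hj, rfl⟩ := (Nat.dvd_prime_pow Nat.prime_three).1 hb
  obtain rfl | rfl := (Nat.dvd_prime Nat.prime_two).1 ha
  · exact absurd (by simpa using hb) h₁
  · obtain hj | rfl := Nat.lt_or_eq_of_le hj
    · exact absurd (Nat.mul_dvd_mul_left 2 (pow_dvd_pow 3 (Nat.le_of_lt_succ hj))) h₂
    · rfl

lemma minimalPeriod_initConf (q : Arrow) :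
    minimalPeriod (shiftStep (n + 2)) (Quotient.mk _ (initConf (n + 2) q)) = 2 * 3 ^ (n + 2) := by
  apply eq_two_mul_three_pow
  · apply IsPeriodicPt.minimalPeriod_dvd
    rw [IsPeriodicPt, IsFixedPt, shiftStep_iterate_mk, iterate_initConf]
    exact Quotient.sound ⟨-disp (n + 2) q, by simp [sub_eq_add_neg]⟩
  · intro h
    obtain ⟨k, hk⟩ : Odd (3 ^ (n + 2)) := Odd.pow (by decide)
    have e := isPeriodicPt_iff_minimalPeriod_dvd.2 h
    rw [IsPeriodicPt, IsFixedPt, shiftStep_iterate_mk, hk,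
      add_comm (2 * k), iterate_add_apply, iterate_one, iterate_two_mul_initConf,
      stepC_headConf_match] at e
    exact absurd (congrArg Prod.snd (state_eq_of_mk_headConf_eq e)) one_ne_zero
  · intro h
    obtain ⟨k, hk⟩ := exists_iterate_blank_ne n q
    have e := isPeriodicPt_iff_minimalPeriod_dvd.2 (h.mul_left k)
    rw [IsPeriodicPt, IsFixedPt, shiftStep_iterate_mk, mul_left_comm,
      iterate_two_mul_initConf] at e
    exact hk (congrArg Prod.fst (state_eq_of_mk_headConf_eq e))

end Smart

/-- **Proposition.** For `ℓ ≥ 2`, the `(2·3^ℓ)`-th power of the SMART machine acting on the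
cyclic initial configurations `C_▶, C_▷` (resp. `C_◀, C_◁`) of length `ℓ` is a right shift
(resp. a left shift), and the intermediate configurations are pairwise distinct even up to
a shift. -/
theorem smart_eventually_shifts (ℓ : ℕ) (hℓ : 2 ≤ ℓ) :
    ((stepC smartStep ℓ)^[2 * 3 ^ ℓ] (initConf ℓ .rf) = fun i => initConf ℓ .rf (i - 1)) ∧
    ((stepC smartStep ℓ)^[2 * 3 ^ ℓ] (initConf ℓ .rh) = fun i => initConf ℓ .rh (i - 1)) ∧
    ((stepC smartStep ℓ)^[2 * 3 ^ ℓ] (initConf ℓ .lf) = fun i => initConf ℓ .lf (i + 1)) ∧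
    ((stepC smartStep ℓ)^[2 * 3 ^ ℓ] (initConf ℓ .lh) = fun i => initConf ℓ .lh (i + 1)) ∧
    (∀ q : Arrow, ∀ i j : ℕ, i < j → j < 2 * 3 ^ ℓ → ∀ m : ZMod ℓ,
      (stepC smartStep ℓ)^[i] (initConf ℓ q) ≠
        fun t => (stepC smartStep ℓ)^[j] (initConf ℓ q) (t + m)) := by
  obtain ⟨n, rfl⟩ := Nat.exists_eq_add_of_le' hℓ
  refine ⟨Smart.iterate_initConf n .rf, Smart.iterate_initConf n .rh, ?_, ?_, ?_⟩
  · simpa [Smart.disp, Smart.pointsRight] using Smart.iterate_initConf n .lf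
  · simpa [Smart.disp, Smart.pointsRight] using Smart.iterate_initConf n .lh
  · intro q i j hij hj m e
    have hinj := Function.iterate_injOn_Iio_minimalPeriod (f := Smart.shiftStep (n + 2))
      (x := Quotient.mk _ (initConf (n + 2) q))
    rw [Smart.minimalPeriod_initConf] at hinj
    refine hij.ne (hinj (hij.trans hj) hj ?_)
    simp only [Smart.shiftStep_iterate_mk]
    exact Quotient.sound ⟨m, e⟩
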